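/- Let Ū : (−1,1) → ℝ be continuous with constants u₋, u₊ ∈ ℝ, α ∈ (0,1], C₀ > 0 such that |Ū(x) − u₋| ≤ C₀(1+x)^α on (−1,0] and |Ū(x) − u₊| ≤ C₀(1−x)^α on [0,1). Let ε ∈ (0,1/2) satisfy ε > max{0, u₋/2 − 1, −1 − u₊/2}, and let ξφ : (−1,1) → ℝ be continuous with |ξφ(x)| ≤ N(1−x²)^{−1−ε} for all x. Then W_φ(x) := ∫₀ˣ e^{−b(t)} ∫₀ᵗ e^{b(s)} ξφ(s)/(1−s²) ds dt is well-defined and C² on (−1,1), satisfies (1−x²)W_φ''(x) + Ū(x)W_φ'(x) = ξφ(x), and there exists C > 0 depending only on ε, u₋, u₊, α, C₀ such that for all x ∈ (−1,1): (1−x²)^{ε}|W_φ(x)| ≤ C·N, (1−x²)^{1+ε}|W_φ'(x)| ≤ C·N, and (1−x²)^{2+ε}|W_φ''(x)| ≤ C·N. -/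

import Mathlib

open Set Filter

/-- `b(x) = ∫₀ˣ Ū(s)/(1−s²) ds`. -/
noncomputable def bF (U : ℝ → ℝ) (x : ℝ) : ℝ := ∫ s in (0:ℝ)..x, U s / (1 - s^2)

/-- The flux `∫₀ᵗ e^{b(s)} ξ(s)/(1−s²) ds`. -/
noncomputable def weightedFlux (U ξ : ℝ → ℝ) (t : ℝ) : ℝ :=
  ∫ s in (0:ℝ)..t, Real.exp (bF U s) * ξ s / (1-s^2)

/-- The solution `∫₀ˣ e^{−b(t)} ∫₀ᵗ e^{b(s)} ξ(s)/(1−s²) ds dt`. -/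
noncomputable def weightedSolution (U ξ : ℝ → ℝ) (x : ℝ) : ℝ :=
  ∫ t in (0:ℝ)..x, Real.exp (-(bF U t)) * weightedFlux U ξ t

lemma one_sub_sq_pos_of_mem_Ioo {x : ℝ} (hx : x ∈ Ioo (-1:ℝ) 1) : 0 < 1 - x^2 := by
  nlinarith [hx.1, hx.2]

lemma hasDerivAt_integral_of_continuousOn_Ioo {f : ℝ → ℝ} {x : ℝ}
    (hf : ContinuousOn f (Ioo (-1:ℝ) 1)) (hx : x ∈ Ioo (-1:ℝ) 1) :
    HasDerivAt (fun y => ∫ t in (0:ℝ)..y, f t) (f x) x := by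
  have hsub : uIcc (0:ℝ) x ⊆ Ioo (-1:ℝ) 1 :=
    ordConnected_Ioo.uIcc_subset (by norm_num) hx
  exact intervalIntegral.integral_hasDerivAt_right
    (hf.mono hsub).intervalIntegrable
    (hf.stronglyMeasurableAtFilter isOpen_Ioo x hx)
    (hf.continuousAt (isOpen_Ioo.mem_nhds hx))

lemma continuousOn_integral_of_continuousOn_Ioo {f : ℝ → ℝ}
    (hf : ContinuousOn f (Ioo (-1:ℝ) 1)) :
    ContinuousOn (fun y => ∫ t in (0:ℝ)..y, f t) (Ioo (-1:ℝ) 1) := fun _ hx =>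
  (hasDerivAt_integral_of_continuousOn_Ioo hf hx).continuousAt.continuousWithinAt

lemma continuousOn_bF_integrand {U : ℝ → ℝ} (hU : ContinuousOn U (Ioo (-1:ℝ) 1)) :
    ContinuousOn (fun s => U s / (1 - s^2)) (Ioo (-1:ℝ) 1) :=
  hU.div (by fun_prop) fun _ hx => (one_sub_sq_pos_of_mem_Ioo hx).ne'

lemma continuousOn_bF {U : ℝ → ℝ} (hU : ContinuousOn U (Ioo (-1:ℝ) 1)) :
    ContinuousOn (bF U) (Ioo (-1:ℝ) 1) :=
  continuousOn_integral_of_continuousOn_Ioo (continuousOn_bF_integrand hU)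

lemma hasDerivAt_bF {U : ℝ → ℝ} {x : ℝ} (hU : ContinuousOn U (Ioo (-1:ℝ) 1))
    (hx : x ∈ Ioo (-1:ℝ) 1) : HasDerivAt (bF U) (U x / (1 - x^2)) x :=
  hasDerivAt_integral_of_continuousOn_Ioo (continuousOn_bF_integrand hU) hx

lemma hasDerivAt_weightedFlux {U ξ : ℝ → ℝ} {x : ℝ} (hU : ContinuousOn U (Ioo (-1:ℝ) 1))
    (hξ : ContinuousOn ξ (Ioo (-1:ℝ) 1)) (hx : x ∈ Ioo (-1:ℝ) 1) :
    HasDerivAt (weightedFlux U ξ) (Real.exp (bF U x) * ξ x / (1 - x^2)) x :=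
  hasDerivAt_integral_of_continuousOn_Ioo
    (((continuousOn_bF hU).rexp.mul hξ).div (by fun_prop)
      fun _ hy => (one_sub_sq_pos_of_mem_Ioo hy).ne') hx

lemma hasDerivAt_weightedSolution {U ξ : ℝ → ℝ} {x : ℝ} (hU : ContinuousOn U (Ioo (-1:ℝ) 1))
    (hξ : ContinuousOn ξ (Ioo (-1:ℝ) 1)) (hx : x ∈ Ioo (-1:ℝ) 1) :
    HasDerivAt (weightedSolution U ξ) (Real.exp (-(bF U x)) * weightedFlux U ξ x) x :=
  hasDerivAt_integral_of_continuousOn_Ioo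
    ((continuousOn_bF hU).neg.rexp.mul fun _ hy =>
      (hasDerivAt_weightedFlux hU hξ hy).continuousAt.continuousWithinAt) hx

lemma integral_zero_comp_neg (f : ℝ → ℝ) (x : ℝ) :
    ∫ s in (0:ℝ)..x, f (-s) = -∫ s in (0:ℝ)..(-x), f s := by
  rw [intervalIntegral.integral_comp_neg, neg_zero, intervalIntegral.integral_symm]

lemma bF_reflect (U : ℝ → ℝ) (x : ℝ) : bF (fun s => -U (-s)) x = bF U (-x) := by
  have h := integral_zero_comp_neg (fun s => U s / (1 - s^2)) x
  simp only [neg_sq] at h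
  simp only [bF, neg_div, intervalIntegral.integral_neg, h, neg_neg]

lemma weightedFlux_reflect (U ξ : ℝ → ℝ) (x : ℝ) :
    weightedFlux (fun s => -U (-s)) (fun s => ξ (-s)) x = -weightedFlux U ξ (-x) := by
  have h := integral_zero_comp_neg (fun s => Real.exp (bF U s) * ξ s / (1 - s^2)) x
  simp only [neg_sq] at h
  simpa only [weightedFlux, bF_reflect] using h

lemma weightedSolution_reflect (U ξ : ℝ → ℝ) (x : ℝ) :
    weightedSolution (fun s => -U (-s)) (fun s => ξ (-s)) x = weightedSolution U ξ (-x) := by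
  have h := integral_zero_comp_neg (fun s => Real.exp (-(bF U s)) * weightedFlux U ξ s) x
  simp only [weightedSolution, bF_reflect, weightedFlux_reflect, mul_neg,
    intervalIntegral.integral_neg, h, neg_neg]

lemma abs_le_of_abs_deriv_le_on_Ico {f f' B B' : ℝ → ℝ}
    (hf : ∀ x ∈ Ico (0:ℝ) 1, HasDerivAt f (f' x) x)
    (hB : ∀ x ∈ Ico (0:ℝ) 1, HasDerivAt B (B' x) x)
    (h0 : |f 0| ≤ B 0) (hbound : ∀ x ∈ Ico (0:ℝ) 1, |f' x| ≤ B' x) :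
    ∀ x ∈ Ico (0:ℝ) 1, |f x| ≤ B x := by
  intro x hx
  have hmem : ∀ y ∈ Icc 0 x, y ∈ Ico (0:ℝ) 1 := fun y hy => ⟨hy.1, hy.2.trans_lt hx.2⟩
  have hmem' : ∀ y ∈ Ico 0 x, y ∈ Ico (0:ℝ) 1 := fun y hy => hmem y (Ico_subset_Icc_self hy)
  exact image_norm_le_of_norm_deriv_right_le_deriv_boundary' (a := 0) (b := x)
    (fun y hy => (hf y (hmem y hy)).continuousAt.continuousWithinAt)
    (fun y hy => (hf y (hmem' y hy)).hasDerivWithinAt) h0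
    (fun y hy => (hB y (hmem y hy)).continuousAt.continuousWithinAt)
    (fun y hy => (hB y (hmem' y hy)).hasDerivWithinAt)
    (fun y hy => hbound y (hmem' y hy)) (right_mem_Icc.2 hx.1)

lemma hasDerivAt_one_sub_rpow {x : ℝ} (hx : x < 1) (p : ℝ) :
    HasDerivAt (fun y : ℝ => (1 - y) ^ p) (-(p * (1 - x) ^ (p - 1))) x := by
  have h := ((hasDerivAt_id x).const_sub 1).rpow_const (p := p)
    (Or.inl (sub_pos.2 hx).ne')
  exact h.congr_deriv (by simp)

lemma abs_bF_add_log_le {U : ℝ → ℝ} {u α C₀ : ℝ} (hα : 0 < α) (hC₀ : 0 < C₀)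
    (hU : ContinuousOn U (Ioo (-1:ℝ) 1))
    (hup : ∀ x ∈ Ico (0:ℝ) 1, |U x - u| ≤ C₀ * (1-x) ^ α) :
    ∀ x ∈ Ico (0:ℝ) 1, |bF U x + u / 2 * Real.log (1 - x)| ≤ C₀ / α + |u| / 2 := by
  intro x hx
  have key := abs_le_of_abs_deriv_le_on_Ico
    (f := fun y => bF U y + u / 2 * Real.log (1 - y))
    (f' := fun y => U y / (1 - y^2) + u / 2 * (-1 / (1 - y)))
    (B := fun y => C₀ / α * (1 - (1 - y) ^ α) + |u| / 2 * y)
    (B' := fun y => C₀ / α * (-(-(α * (1 - y) ^ (α - 1)))) + |u| / 2 * 1)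
    (fun y hy => (hasDerivAt_bF hU ⟨by linarith [hy.1], hy.2⟩).add
      ((((hasDerivAt_id y).const_sub 1).log (sub_pos.2 hy.2).ne').const_mul _))
    (fun y hy => (((hasDerivAt_one_sub_rpow hy.2 α).const_sub 1).const_mul _).add
      ((hasDerivAt_id y).const_mul _))
    (by simp [bF]) ?_ x hx
  · refine key.trans ?_
    have h1 : 0 ≤ (1 - x) ^ α := Real.rpow_nonneg (sub_nonneg.2 hx.2.le) _
    have h2 : 0 < C₀ / α := by positivity
    have h3 := mul_nonneg h2.le h1
    have h4 := mul_le_mul_of_nonneg_left hx.2.le (by positivity : 0 ≤ |u| / 2)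
    linarith
  · intro y hy
    have hy1 : 0 < 1 - y := sub_pos.2 hy.2
    have hy2 : 1 ≤ 1 + y := by linarith [hy.1]
    have hsq : 1 - y^2 = (1 - y) * (1 + y) := by ring
    have hdec : U y / (1 - y^2) + u / 2 * (-1 / (1 - y))
        = (U y - u) / (1 - y) / (1 + y) + u / 2 / (1 + y) := by
      rw [hsq]; field_simp; ring
    have e1 : |(U y - u) / (1 - y) / (1 + y)| ≤ C₀ * (1 - y) ^ (α - 1) := by
      rw [abs_div, abs_div, abs_of_pos hy1, abs_of_pos (by linarith : 0 < 1 + y),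
        Real.rpow_sub_one hy1.ne', ← mul_div_assoc]
      refine (div_le_self (by positivity) hy2).trans ?_
      gcongr
      exact hup y hy
    have e2 : |u / 2 / (1 + y)| ≤ |u| / 2 := by
      rw [abs_div, abs_div, abs_of_pos (by linarith : 0 < 1 + y), abs_two]
      exact div_le_self (by positivity) hy2
    rw [hdec, neg_neg, mul_one, ← mul_assoc, div_mul_cancel₀ _ hα.ne']
    exact (abs_add_le _ _).trans (add_le_add e1 e2)

lemma exists_right_bound (u α C₀ ε : ℝ) (hα : 0 < α) (hC₀ : 0 < C₀) (hε1 : 0 < ε)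
    (hεp : -1 - u/2 < ε) :
    ∃ C > 0, ∀ (U ξ : ℝ → ℝ) (N : ℝ),
      ContinuousOn U (Ioo (-1:ℝ) 1) →
      (∀ x ∈ Ico (0:ℝ) 1, |U x - u| ≤ C₀ * (1-x) ^ α) →
      ContinuousOn ξ (Ioo (-1:ℝ) 1) → 0 ≤ N →
      (∀ x ∈ Ico (0:ℝ) 1, |ξ x| ≤ N * (1-x^2) ^ (-1-ε)) →
      ∀ x ∈ Ico (0:ℝ) 1,
        |weightedSolution U ξ x| ≤ C * N * (1 - x) ^ (-ε) ∧
        |Real.exp (-(bF U x)) * weightedFlux U ξ x| ≤ C * N * (1 - x) ^ (-1-ε) := by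
  set K := C₀ / α + |u| / 2 with hK
  set γ := 1 + ε + u / 2 with hγ
  have hγ0 : 0 < γ := by rw [hγ]; linarith
  set D := Real.exp K * (Real.exp K / γ) with hD
  have hD0 : 0 < D := by positivity
  refine ⟨D + D / ε, by positivity, fun U ξ N hU hup hξ hN hξN => ?_⟩
  have hb : ∀ x ∈ Ico (0:ℝ) 1, |bF U x + u / 2 * Real.log (1 - x)| ≤ K :=
    abs_bF_add_log_le hα hC₀ hU hup
  have hexp : ∀ x ∈ Ico (0:ℝ) 1, Real.exp (bF U x) ≤ Real.exp K * (1 - x) ^ (-(u/2)) := by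
    intro x hx
    rw [Real.rpow_def_of_pos (sub_pos.2 hx.2), ← Real.exp_add]
    exact Real.exp_le_exp.2 (by linarith [(abs_le.1 (hb x hx)).2])
  have hexp' : ∀ x ∈ Ico (0:ℝ) 1, Real.exp (-(bF U x)) ≤ Real.exp K * (1 - x) ^ (u/2) := by
    intro x hx
    rw [Real.rpow_def_of_pos (sub_pos.2 hx.2), ← Real.exp_add]
    exact Real.exp_le_exp.2 (by linarith [(abs_le.1 (hb x hx)).1])
  have hIoo : ∀ x ∈ Ico (0:ℝ) 1, x ∈ Ioo (-1:ℝ) 1 := fun x hx => ⟨by linarith [hx.1], hx.2⟩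
  have hflux : ∀ x ∈ Ico (0:ℝ) 1,
      |weightedFlux U ξ x| ≤ Real.exp K * N / γ * ((1 - x) ^ (-γ) - 1) := by
    refine abs_le_of_abs_deriv_le_on_Ico
      (fun y hy => hasDerivAt_weightedFlux hU hξ (hIoo y hy))
      (fun y hy => ((hasDerivAt_one_sub_rpow hy.2 (-γ)).sub_const 1).const_mul _)
      (by simp [weightedFlux]) ?_
    intro y hy
    have hy1 : 0 < 1 - y := sub_pos.2 hy.2
    have hy2 : 0 < 1 - y^2 := one_sub_sq_pos_of_mem_Ioo (hIoo y hy)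
    have hle : 1 - y ≤ 1 - y^2 := by nlinarith [hy.1, hy.2]
    rw [abs_div, abs_mul, Real.abs_exp, abs_of_pos hy2]
    calc Real.exp (bF U y) * |ξ y| / (1 - y^2)
        ≤ (Real.exp K * (1 - y) ^ (-(u/2))) * (N * (1 - y^2) ^ (-1-ε)) / (1 - y^2) := by
          gcongr
          · exact hexp y hy
          · exact hξN y hy
      _ = Real.exp K * N * (1 - y) ^ (-(u/2)) * (1 - y^2) ^ (-1-ε-1) := by
          rw [Real.rpow_sub_one hy2.ne' (-1-ε)]; ring
      _ ≤ Real.exp K * N * (1 - y) ^ (-(u/2)) * (1 - y) ^ (-1-ε-1) := by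
          gcongr ?_ * ?_
          exact Real.rpow_le_rpow_of_nonpos hy1 hle (by linarith)
      _ = Real.exp K * N * (1 - y) ^ (-γ - 1) := by
          rw [mul_assoc, ← Real.rpow_add hy1]
          congr 2
          rw [hγ]; ring
      _ = _ := by field_simp
  have hW' : ∀ x ∈ Ico (0:ℝ) 1,
      |Real.exp (-(bF U x)) * weightedFlux U ξ x| ≤ D * N * (1 - x) ^ (-1-ε) := by
    intro x hx
    have hx1 : 0 < 1 - x := sub_pos.2 hx.2
    rw [abs_mul, Real.abs_exp]
    have h1 : |weightedFlux U ξ x| ≤ Real.exp K * N / γ * (1 - x) ^ (-γ) := by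
      refine (hflux x hx).trans ?_
      gcongr
      linarith
    calc Real.exp (-(bF U x)) * |weightedFlux U ξ x|
        ≤ (Real.exp K * (1 - x) ^ (u/2)) * (Real.exp K * N / γ * (1 - x) ^ (-γ)) := by
          gcongr
          exact hexp' x hx
      _ = D * N * ((1 - x) ^ (u/2) * (1 - x) ^ (-γ)) := by rw [hD]; ring
      _ = _ := by
          rw [← Real.rpow_add hx1]
          congr 2
          rw [hγ]; ring
  have hW : ∀ x ∈ Ico (0:ℝ) 1,
      |weightedSolution U ξ x| ≤ D * N / ε * ((1 - x) ^ (-ε) - 1) := by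
    refine abs_le_of_abs_deriv_le_on_Ico
      (fun y hy => hasDerivAt_weightedSolution hU hξ (hIoo y hy))
      (fun y hy => ((hasDerivAt_one_sub_rpow hy.2 (-ε)).sub_const 1).const_mul _)
      (by simp [weightedSolution]) ?_
    intro y hy
    refine (hW' y hy).trans_eq ?_
    rw [show -ε - 1 = -1 - ε by ring]
    field_simp
  intro x hx
  have hx1 : 0 < 1 - x := sub_pos.2 hx.2
  constructor
  · calc |weightedSolution U ξ x| ≤ D * N / ε * ((1 - x) ^ (-ε) - 1) := hW x hx
      _ ≤ D * N / ε * (1 - x) ^ (-ε) := by gcongr; linarith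
      _ = D / ε * N * (1 - x) ^ (-ε) := by ring
      _ ≤ (D + D / ε) * N * (1 - x) ^ (-ε) := by gcongr; linarith
  · refine (hW' x hx).trans ?_
    gcongr
    linarith [div_pos hD0 hε1]

lemma rpow_one_sub_sq_mul_le {x p A B : ℝ} (hx : x ∈ Ico (0:ℝ) 1) (hp2 : p ≤ 2)
    (hA : 0 ≤ A) (h : B ≤ A * (1 - x) ^ (-p)) : (1 - x^2) ^ p * B ≤ 4 * A := by
  have hx1 : 0 < 1 - x := sub_pos.2 hx.2
  have hx2 : 1 ≤ 1 + x := by linarith [hx.1]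
  have h4 : (1 + x) ^ p ≤ 4 := by
    calc (1 + x) ^ p ≤ (1 + x) ^ (2:ℝ) := Real.rpow_le_rpow_of_exponent_le hx2 hp2
      _ = (1 + x) ^ 2 := Real.rpow_two _
      _ ≤ 4 := by nlinarith [hx.1, hx.2]
  have hmul : (1 - x) ^ p * (1 - x) ^ (-p) = 1 := by
    rw [← Real.rpow_add hx1, add_neg_cancel, Real.rpow_zero]
  rw [show 1 - x^2 = (1 - x) * (1 + x) by ring, Real.mul_rpow hx1.le (by linarith)]
  calc (1 - x) ^ p * (1 + x) ^ p * B
      ≤ (1 - x) ^ p * (1 + x) ^ p * (A * (1 - x) ^ (-p)) := by gcongr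
    _ = (1 + x) ^ p * A * ((1 - x) ^ p * (1 - x) ^ (-p)) := by ring
    _ = (1 + x) ^ p * A := by rw [hmul, mul_one]
    _ ≤ 4 * A := by gcongr

lemma abs_le_add_of_abs_sub_le_rpow {v u C₀ α y : ℝ} (hC₀ : 0 < C₀) (hα : 0 < α)
    (hy : 0 ≤ y) (hy1 : y ≤ 1) (h : |v - u| ≤ C₀ * y ^ α) : |v| ≤ |u| + C₀ := by
  have h1 : y ^ α ≤ 1 := Real.rpow_le_one hy hy1 hα.le
  have h2 := mul_le_of_le_one_right hC₀.le h1
  have h3 := abs_sub_abs_le_abs_sub v u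
  linarith

/-- the operator
`W_φ(x) = ∫₀ˣ e^{−b(t)} ∫₀ᵗ e^{b(s)} ξφ(s)/(1−s²) ds dt` solves
`(1−x²)W_φ'' + Ū W_φ' = ξφ` with weighted `C·N` bounds. -/
theorem stmt13 (um up α C₀ ε : ℝ)
    (hα : 0 < α) (hα1 : α ≤ 1) (hC₀ : 0 < C₀)
    (hε1 : 0 < ε) (hε2 : ε < 1/2)
    (hεm : um/2 - 1 < ε) (hεp : -1 - up/2 < ε) :
    ∃ C > 0, ∀ (U ξφ : ℝ → ℝ) (N : ℝ),
      ContinuousOn U (Ioo (-1:ℝ) 1) →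
      (∀ x ∈ Ioc (-1:ℝ) 0, |U x - um| ≤ C₀ * (1+x) ^ α) →
      (∀ x ∈ Ico (0:ℝ) 1, |U x - up| ≤ C₀ * (1-x) ^ α) →
      ContinuousOn ξφ (Ioo (-1:ℝ) 1) →
      (∀ x ∈ Ioo (-1:ℝ) 1, |ξφ x| ≤ N * (1-x^2) ^ (-1-ε)) →
      (let Wφ : ℝ → ℝ := fun x =>
        ∫ t in (0:ℝ)..x,
          Real.exp (-(bF U t)) * ∫ s in (0:ℝ)..t, Real.exp (bF U s) * ξφ s / (1-s^2)
       ∃ Wφ' Wφ'' : ℝ → ℝ,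
        (∀ x ∈ Ioo (-1:ℝ) 1, HasDerivAt Wφ (Wφ' x) x) ∧
        (∀ x ∈ Ioo (-1:ℝ) 1, HasDerivAt Wφ' (Wφ'' x) x) ∧
        ContinuousOn Wφ'' (Ioo (-1:ℝ) 1) ∧
        (∀ x ∈ Ioo (-1:ℝ) 1, (1-x^2) * Wφ'' x + U x * Wφ' x = ξφ x) ∧
        (∀ x ∈ Ioo (-1:ℝ) 1,
          (1-x^2) ^ ε * |Wφ x| ≤ C * N ∧
          (1-x^2) ^ (1+ε) * |Wφ' x| ≤ C * N ∧
          (1-x^2) ^ (2+ε) * |Wφ'' x| ≤ C * N)) := by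
  obtain ⟨Cp, hCp, hright⟩ := exists_right_bound up α C₀ ε hα hC₀ hε1 hεp
  obtain ⟨Cm, hCm, hleft⟩ := exists_right_bound (-um) α C₀ ε hα hC₀ hε1 (by linarith)
  set M := |um| + |up| + C₀ with hM
  have hM0 : 0 < M := by positivity
  set E := 4 * (Cp + Cm) with hE
  have hE0 : 0 < E := by positivity
  refine ⟨E + (1 + M * E), by positivity, fun U ξ N hU hum hup hξ hξN => ?_⟩
  have hN : 0 ≤ N := by simpa using (abs_nonneg _).trans (hξN 0 (by norm_num))
  change ∃ Wφ' Wφ'' : ℝ → ℝ,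
    (∀ x ∈ Ioo (-1:ℝ) 1, HasDerivAt (weightedSolution U ξ) (Wφ' x) x) ∧
    (∀ x ∈ Ioo (-1:ℝ) 1, HasDerivAt Wφ' (Wφ'' x) x) ∧
    ContinuousOn Wφ'' (Ioo (-1:ℝ) 1) ∧
    (∀ x ∈ Ioo (-1:ℝ) 1, (1-x^2) * Wφ'' x + U x * Wφ' x = ξ x) ∧
    (∀ x ∈ Ioo (-1:ℝ) 1,
      (1-x^2) ^ ε * |weightedSolution U ξ x| ≤ (E + (1 + M * E)) * N ∧
      (1-x^2) ^ (1+ε) * |Wφ' x| ≤ (E + (1 + M * E)) * N ∧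
      (1-x^2) ^ (2+ε) * |Wφ'' x| ≤ (E + (1 + M * E)) * N)
  set W' : ℝ → ℝ := fun x => Real.exp (-(bF U x)) * weightedFlux U ξ x with hW'def
  have hW'deriv : ∀ x ∈ Ioo (-1:ℝ) 1, HasDerivAt W' ((ξ x - U x * W' x) / (1 - x^2)) x := by
    intro x hx
    have h := (hasDerivAt_bF hU hx).neg.exp.mul (hasDerivAt_weightedFlux hU hξ hx)
    refine h.congr_deriv ?_
    have hne := (one_sub_sq_pos_of_mem_Ioo hx).ne'
    have hee : Real.exp (-(bF U x)) * Real.exp (bF U x) = 1 := by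
      rw [← Real.exp_add, neg_add_cancel, Real.exp_zero]
    simp only [hW'def, Pi.neg_apply]
    field_simp
    linear_combination ξ x * hee
  have hsides : ∀ x ∈ Ioo (-1:ℝ) 1, (1-x^2) ^ ε * |weightedSolution U ξ x| ≤ E * N ∧
      (1-x^2) ^ (1+ε) * |W' x| ≤ E * N ∧ |U x| ≤ M := by
    intro x hx
    rcases le_total 0 x with h0 | h0
    · have hx' : x ∈ Ico (0:ℝ) 1 := ⟨h0, hx.2⟩
      obtain ⟨h1, h2⟩ := hright U ξ N hU hup hξ hN
        (fun y hy => hξN y ⟨by linarith [hy.1], hy.2⟩) x hx'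
      have hle : 4 * (Cp * N) ≤ E * N := by rw [hE]; nlinarith [mul_nonneg hCm.le hN]
      refine ⟨(rpow_one_sub_sq_mul_le hx' (by linarith) (by positivity) h1).trans hle,
        (rpow_one_sub_sq_mul_le hx' (by linarith) (by positivity)
          (by rwa [neg_add'])).trans hle, ?_⟩
      have := abs_le_add_of_abs_sub_le_rpow hC₀ hα (by linarith [hx.2]) (by linarith) (hup x hx')
      linarith [abs_nonneg um]
    · have hx' : -x ∈ Ico (0:ℝ) 1 := ⟨by linarith, by linarith [hx.1]⟩
      have hneg : MapsTo (fun y : ℝ => -y) (Ioo (-1:ℝ) 1) (Ioo (-1:ℝ) 1) :=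
        fun y hy => ⟨by linarith [hy.2], by linarith [hy.1]⟩
      obtain ⟨h1, h2⟩ := hleft (fun s => -U (-s)) (fun s => ξ (-s)) N
        (hU.comp continuousOn_neg hneg).neg
        (fun y hy => by
          have := hum (-y) ⟨by linarith [hy.2], by linarith [hy.1]⟩
          rw [← abs_neg] at this
          simpa only [neg_sub, sub_neg_eq_add, neg_add_eq_sub, ← sub_eq_add_neg] using this)
        (hξ.comp continuousOn_neg hneg) hN
        (fun y hy => by
          simpa using hξN (-y) ⟨by linarith [hy.2], by linarith [hy.1]⟩) (-x) hx'
      simp only [weightedSolution_reflect, weightedFlux_reflect, bF_reflect, neg_neg, mul_neg,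
        abs_neg] at h1 h2
      have hle : 4 * (Cm * N) ≤ E * N := by rw [hE]; nlinarith [mul_nonneg hCp.le hN]
      have k1 := rpow_one_sub_sq_mul_le hx' (by linarith) (by positivity) h1
      have k2 := rpow_one_sub_sq_mul_le (p := 1 + ε) (A := Cm * N) (B := |W' x|) hx'
        (by linarith) (by positivity) (by rw [neg_add']; exact h2)
      rw [neg_sq] at k1 k2
      refine ⟨k1.trans hle, k2.trans hle, ?_⟩
      have := abs_le_add_of_abs_sub_le_rpow hC₀ hα (by linarith [hx.1]) (by linarith)
        (hum x ⟨hx.1, h0⟩)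
      linarith [abs_nonneg up]
  refine ⟨W', fun x => (ξ x - U x * W' x) / (1 - x^2),
    fun x hx => hasDerivAt_weightedSolution hU hξ hx, hW'deriv, ?_, ?_, ?_⟩
  · exact (hξ.sub (hU.mul fun x hx => (hW'deriv x hx).continuousAt.continuousWithinAt)).div
      (by fun_prop) fun _ hx => (one_sub_sq_pos_of_mem_Ioo hx).ne'
  · intro x hx
    have hne := (one_sub_sq_pos_of_mem_Ioo hx).ne'
    dsimp only
    rw [mul_div_cancel₀ _ hne]
    ring
  · intro x hx
    obtain ⟨h1, h2, h3⟩ := hsides x hx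
    have hpos := one_sub_sq_pos_of_mem_Ioo hx
    have hEN : 0 ≤ E * N := by positivity
    have hMEN : 0 ≤ (1 + M * E) * N := by positivity
    refine ⟨by linarith, by linarith, ?_⟩
    have hp : 0 ≤ (1 - x^2) ^ (1+ε) := Real.rpow_nonneg hpos.le _
    have e1 : (1 - x^2) ^ (1+ε) * |ξ x| ≤ N := by
      calc (1 - x^2) ^ (1+ε) * |ξ x|
          ≤ (1 - x^2) ^ (1+ε) * (N * (1 - x^2) ^ (-1-ε)) := by gcongr; exact hξN x hx
        _ = N * ((1 - x^2) ^ (1+ε) * (1 - x^2) ^ (-1-ε)) := by ring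
        _ = N := by
            rw [← Real.rpow_add hpos, show 1 + ε + (-1 - ε) = 0 by ring, Real.rpow_zero, mul_one]
    have e2 : |ξ x - U x * W' x| ≤ |ξ x| + |U x| * |W' x| := by
      rw [← abs_mul]; exact abs_sub _ _
    calc (1 - x^2) ^ (2+ε) * |(ξ x - U x * W' x) / (1 - x^2)|
        = (1 - x^2) ^ (1+ε) * |ξ x - U x * W' x| := by
          rw [show 2 + ε = 1 + ε + 1 by ring, Real.rpow_add_one hpos.ne', abs_div,
            abs_of_pos hpos]
          field_simp
      _ ≤ (1 - x^2) ^ (1+ε) * (|ξ x| + |U x| * |W' x|) := by gcongr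
      _ = (1 - x^2) ^ (1+ε) * |ξ x| + |U x| * ((1 - x^2) ^ (1+ε) * |W' x|) := by ring
      _ ≤ N + M * (E * N) := by gcongr
      _ ≤ (E + (1 + M * E)) * N := by linarith
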